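/- Let n and c be positive integers with c ≥ 3. There exists an n-element polyunsaturated poset P with height c if and only if n ≥ binom(c, 2). Moreover, P may be required to have order dimension at most 2. -/

import Mathlib

/-- The maximum cardinality of a union of `k` antichains (a `k`-family)
with respect to the relation `r`. -/
noncomputable def dFam {α : Type*} (r : α → α → Prop) (k : ℕ) : ℕ :=
  sSup {n | ∃ A : Fin k → Set α, (∀ i, IsAntichain r (A i)) ∧ (⋃ i, A i).ncard = n}

/-- The height of a poset: the maximum cardinality of a chain. -/
noncomputable def heightPO {α : Type*} (r : α → α → Prop) : ℕ :=
  sSup {n | ∃ s : Set α, IsChain r s ∧ s.ncard = n}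

/-- The width of a poset: the maximum cardinality of an antichain. -/
noncomputable def widthPO {α : Type*} (r : α → α → Prop) : ℕ :=
  sSup {n | ∃ s : Set α, IsAntichain r s ∧ s.ncard = n}

/-- `f` encodes a partition of `α` into chains: its (nonempty) fibers are the chains. -/
def IsChainPartition {α : Type*} (r : α → α → Prop) (f : α → α) : Prop :=
  ∀ i : α, IsChain r (f ⁻¹' {i})

/-- The `k`-norm of the partition encoded by `f`: `Σ_C min (k, |C|)`. -/
noncomputable def knorm {α : Type*} [Fintype α] (f : α → α) (k : ℕ) : ℕ :=
  ∑ i : α, min k (f ⁻¹' {i}).ncard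

/-- A poset is polyunsaturated if no chain partition is simultaneously `k`- and
`l`-saturated for distinct nonconsecutive positive `k, l` below the height. -/
def PolyunsatPO {α : Type*} [Fintype α] (r : α → α → Prop) : Prop :=
  ∀ k l : ℕ, 0 < k → 0 < l → k < heightPO r → l < heightPO r →
    (k + 2 ≤ l ∨ l + 2 ≤ k) →
    ¬ ∃ f : α → α, IsChainPartition r f ∧ knorm f k = dFam r k ∧ knorm f l = dFam r l

/-- A poset has order dimension at most 2: two linear extensions whose
intersection is the order. -/
def DimLE2 {α : Type*} (r : α → α → Prop) : Prop :=
  ∃ L₁ L₂ : α → α → Prop, IsLinearOrder α L₁ ∧ IsLinearOrder α L₂ ∧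
    (∀ x y, r x y → L₁ x y) ∧ (∀ x y, r x y → L₂ x y) ∧
    (∀ x y, r x y ↔ L₁ x y ∧ L₂ x y)

open Finset Function

section Families

variable {α : Type*} [Fintype α] {r : α → α → Prop}

theorem bddAbove_family_card (r : α → α → Prop) (k : ℕ) :
    BddAbove {n | ∃ A : Fin k → Set α, (∀ i, IsAntichain r (A i)) ∧ (⋃ i, A i).ncard = n} := by
  refine ⟨Fintype.card α, ?_⟩
  rintro _ ⟨A, -, rfl⟩
  simpa [Nat.card_eq_fintype_card] using Set.ncard_le_card (⋃ i, A i)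

theorem ncard_iUnion_le_dFam {k : ℕ} {A : Fin k → Set α} (hA : ∀ i, IsAntichain r (A i)) :
    (⋃ i, A i).ncard ≤ dFam r k :=
  le_csSup (bddAbove_family_card r k) ⟨A, hA, rfl⟩

theorem exists_family_ncard_eq_dFam (r : α → α → Prop) (k : ℕ) :
    ∃ A : Fin k → Set α, (∀ i, IsAntichain r (A i)) ∧ (⋃ i, A i).ncard = dFam r k :=
  Nat.sSup_mem (s := {n | ∃ A : Fin k → Set α, (∀ i, IsAntichain r (A i)) ∧
    (⋃ i, A i).ncard = n}) ⟨_, fun _ => ∅, fun _ => Set.subsingleton_empty.isAntichain r, rfl⟩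
    (bddAbove_family_card r k)

theorem bddAbove_chain_card (r : α → α → Prop) :
    BddAbove {n | ∃ s : Set α, IsChain r s ∧ s.ncard = n} := by
  refine ⟨Fintype.card α, ?_⟩
  rintro _ ⟨s, -, rfl⟩
  simpa [Nat.card_eq_fintype_card] using Set.ncard_le_card s

theorem exists_chain_ncard_eq_heightPO (r : α → α → Prop) :
    ∃ s : Set α, IsChain r s ∧ s.ncard = heightPO r :=
  Nat.sSup_mem (s := {n | ∃ s : Set α, IsChain r s ∧ s.ncard = n}) ⟨_, ∅, Set.subsingleton_empty.isChain, rfl⟩ (bddAbove_chain_card r)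

theorem ncard_eq_sum_fibers (f : α → α) (F : Set α) :
    F.ncard = ∑ i, (f ⁻¹' {i} ∩ F).ncard := by
  classical
  rw [Set.ncard_eq_toFinset_card', Finset.card_eq_sum_card_fiberwise (f := f) (t := univ)
    (fun _ _ => mem_coe.2 (mem_univ _))]
  refine Finset.sum_congr rfl fun i _ => ?_
  rw [Set.ncard_eq_toFinset_card']
  congr 1
  ext x
  simp [and_comm]

/-- A chain meets a union of `k` antichains in at most `k` elements. -/
theorem IsChain.ncard_inter_iUnion_le {k : ℕ} {A : Fin k → Set α} {C : Set α}
    (hC : IsChain r C) (hA : ∀ i, IsAntichain r (A i)) :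
    (C ∩ ⋃ i, A i).ncard ≤ min k C.ncard := by
  refine le_min ?_ (Set.ncard_le_ncard Set.inter_subset_left)
  have h : ∀ x : α, ∃ i : ℕ, x ∈ C ∩ (⋃ i, A i) → ∃ h : i < k, x ∈ A ⟨i, h⟩ := by
    intro x
    by_cases hx : x ∈ C ∩ ⋃ i, A i
    · obtain ⟨i, hi⟩ := Set.mem_iUnion.1 hx.2
      exact ⟨i, fun _ => ⟨i.2, hi⟩⟩
    · exact ⟨0, fun h => absurd h hx⟩
  choose g hg using h
  have := Set.ncard_le_ncard_of_injOn (s := C ∩ ⋃ i, A i) (t := (Finset.range k : Set ℕ)) g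
    (fun x hx => by simpa using (hg x hx).1) (by
      intro x hx y hy hxy
      by_contra hne
      obtain ⟨h1, h2⟩ := hg x hx
      obtain ⟨h3, h4⟩ := hg y hy
      have h5 : (⟨g x, h1⟩ : Fin k) = ⟨g y, h3⟩ := Fin.ext hxy
      rw [h5] at h2
      rcases hC hx.1 hy.1 hne with h | h
      · exact hA _ h2 h4 hne h
      · exact hA _ h4 h2 (Ne.symm hne) h)
  simpa [Set.ncard_coe_finset] using this

theorem dFam_le_knorm {f : α → α} (hf : IsChainPartition r f) (k : ℕ) :
    dFam r k ≤ knorm f k := by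
  obtain ⟨A, hA, h⟩ := exists_family_ncard_eq_dFam r k
  rw [← h, ncard_eq_sum_fibers f]
  exact Finset.sum_le_sum fun i _ => (hf i).ncard_inter_iUnion_le hA

theorem dFam_le_card (r : α → α → Prop) (k : ℕ) : dFam r k ≤ Fintype.card α := by
  obtain ⟨A, -, h⟩ := exists_family_ncard_eq_dFam r k
  rw [← h]
  simpa [Nat.card_eq_fintype_card] using Set.ncard_le_card (⋃ i, A i)

theorem dFam_lt_card {k : ℕ} (hk : k < heightPO r) : dFam r k < Fintype.card α := by
  obtain ⟨A, hA, h⟩ := exists_family_ncard_eq_dFam r k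
  obtain ⟨C, hC, hCc⟩ := exists_chain_ncard_eq_heightPO r
  rw [← h, ← Nat.card_eq_fintype_card]
  refine Set.ncard_lt_card fun hU => ?_
  have := hC.ncard_inter_iUnion_le hA
  rw [hU, Set.inter_univ] at this
  omega

theorem dFam_lt_dFam_succ {k : ℕ} (hk : k < heightPO r) : dFam r k < dFam r (k + 1) := by
  obtain ⟨A, hA, h⟩ := exists_family_ncard_eq_dFam r k
  have hlt := dFam_lt_card hk
  obtain ⟨x, hx⟩ : ∃ x, x ∉ ⋃ i, A i := by
    by_contra! hcon
    rw [Set.eq_univ_of_forall hcon, Set.ncard_univ, Nat.card_eq_fintype_card] at h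
    omega
  have hB := ncard_iUnion_le_dFam (r := r) (A := Fin.cons {x} A) (by
    intro i
    refine Fin.cases ?_ (fun i => ?_) i
    · exact Set.subsingleton_singleton.isAntichain r
    · simpa using hA i)
  have hU : (⋃ i, (Fin.cons {x} A : Fin (k + 1) → Set α) i) = insert x (⋃ i, A i) := by
    ext y
    simp
  rw [hU, Set.ncard_insert_of_notMem hx, h] at hB
  omega

end Families

section Duality

variable {α : Type*} [Fintype α]

/-- Integral duality for the assignment problem with nonnegative costs. -/
theorem exists_perm_potentials (c : α → α → ℤ) (hc : ∀ x y, 0 ≤ c x y) :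
    ∃ (σ : Equiv.Perm α) (u v : α → ℤ), (∀ x y, u x + v y ≤ c x y) ∧
      ∀ x, u x + v (σ x) = c x (σ x) := by
  classical
  obtain ⟨_, ⟨u, v, huv, rfl⟩, hmax⟩ := Int.exists_greatest_of_bdd
    (P := fun z => ∃ u v : α → ℤ, (∀ x y, u x + v y ≤ c x y) ∧ ∑ x, (u x + v x) = z)
    ⟨∑ x, c x x, by
      rintro _ ⟨u, v, h, rfl⟩
      exact Finset.sum_le_sum fun x _ => h x x⟩
    ⟨0, 0, 0, by simpa using hc, by simp⟩
  let t : α → Finset α := fun x => {y | u x + v y = c x y}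
  by_cases hall : ∀ s : Finset α, #s ≤ #(s.biUnion t)
  · obtain ⟨f, hf, hft⟩ := (Finset.all_card_le_biUnion_card_iff_exists_injective t).1 hall
    refine ⟨Equiv.ofBijective f (Finite.injective_iff_bijective.1 hf), u, v, huv, fun x => ?_⟩
    simpa [t] using hft x
  · push Not at hall
    obtain ⟨s, hs⟩ := hall
    exfalso
    have := hmax _ ⟨fun x => u x + if x ∈ s then 1 else 0,
      fun y => v y - if y ∈ s.biUnion t then 1 else 0, fun x y => ?_, rfl⟩
    · have e : ∑ x, ((u x + if x ∈ s then 1 else 0) + (v x - if x ∈ s.biUnion t then 1 else 0))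
          = ∑ x, (u x + v x) + (#s : ℤ) - #(s.biUnion t) := by
        have h1 : (#s : ℤ) = ∑ x, if x ∈ s then 1 else 0 := by simp
        have h2 : (#(s.biUnion t) : ℤ) = ∑ x, if x ∈ s.biUnion t then 1 else 0 := by
          simp only [Finset.sum_ite_mem, Finset.univ_inter, Finset.sum_const, nsmul_eq_mul, mul_one]
        rw [h1, h2, ← Finset.sum_add_distrib, ← Finset.sum_sub_distrib]
        exact Finset.sum_congr rfl fun x _ => by ring
      rw [e] at this
      omega
    · have hxy := huv x y
      dsimp only
      by_cases hx : x ∈ s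
      · by_cases hy : y ∈ s.biUnion t
        · simp only [hx, hy, if_true]; omega
        · have : u x + v y ≠ c x y := fun h =>
            hy (Finset.mem_biUnion.2 ⟨x, hx, by simpa [t] using h⟩)
          simp only [hx, hy, if_true, if_false]
          omega
      · simp only [hx, if_false]
        split_ifs <;> omega

/-- The cost of following `p` by `q` in a cyclic arrangement of chains whose
nontrivial chains cost `2 * k + 1` each and whose trivial cycles cost `2`. -/
private noncomputable def linkCost (r : α → α → Prop) (k : ℕ) (p q : α) : ℤ :=
  open Classical in if p = q then 2 else if r p q then 0 else 2 * k + 1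

variable {r : α → α → Prop}

theorem sum_potentials_le_dFam_add [Nonempty α] {k : ℕ} {u v : α → ℤ}
    (hk : 1 ≤ k) (huv : ∀ x y, u x + v y ≤ linkCost r k x y) :
    ∑ x, (u x + v x) ≤ (dFam r k : ℤ) + dFam r (k + 1) := by
  classical
  obtain ⟨x₀, hx₀⟩ := Finite.exists_max v
  have h2 : ∀ x, u x + v x ≤ 2 := fun x => by simpa [linkCost] using huv x x
  have hW : ∀ x y, u x + v y ≤ 2 * k + 1 := fun x y => by
    refine (huv x y).trans ?_
    unfold linkCost
    split_ifs <;> omega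
  let A : ℤ → Set α := fun t => {p | v x₀ - v p ≤ t ∧ t < v x₀ + u p}
  have hA : ∀ t, IsAntichain r (A t) := by
    intro t p hp q hq hne hr
    have := huv p q
    simp only [linkCost, if_neg hne, if_pos hr] at this
    have h3 := hp.2
    have h4 := hq.1
    omega
  have hE := ncard_iUnion_le_dFam (r := r) (k := k + 1) (A := fun s => A (2 * (s : ℕ)))
    fun s => hA _
  have hO := ncard_iUnion_le_dFam (r := r) (k := k) (A := fun s => A (2 * (s : ℕ) + 1))
    fun s => hA _
  set E := ⋃ s : Fin (k + 1), A (2 * (s : ℕ)) with hEdef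
  set O := ⋃ s : Fin k, A (2 * (s : ℕ) + 1) with hOdef
  have memE : ∀ p t, p ∈ A t → 0 ≤ t → t ≤ 2 * k → t % 2 = 0 → p ∈ E := by
    intro p t hp h0 h1 he
    refine Set.mem_iUnion.2 ⟨⟨(t / 2).toNat, by omega⟩, ?_⟩
    have : (2 * (((t / 2).toNat : ℕ) : ℤ)) = t := by omega
    change p ∈ A _
    rwa [this]
  have memO : ∀ p t, p ∈ A t → 0 ≤ t → t ≤ 2 * k → t % 2 = 1 → p ∈ O := by
    intro p t hp h0 h1 he
    refine Set.mem_iUnion.2 ⟨⟨(t / 2).toNat, by omega⟩, ?_⟩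
    have : (2 * (((t / 2).toNat : ℕ) : ℤ)) + 1 = t := by omega
    change p ∈ A _
    rwa [this]
  have key : ∀ p, u p + v p ≤ (if p ∈ O then 1 else 0) + (if p ∈ E then 1 else 0) := by
    intro p
    have a1 := h2 p
    have a2 := hW p x₀
    have a3 := hx₀ p
    by_cases hy : u p + v p ≤ 0
    · split_ifs <;> omega
    have m1 : p ∈ A (v x₀ - v p) := ⟨le_rfl, by omega⟩
    by_cases hy1 : u p + v p = 1
    · rcases Int.emod_two_eq_zero_or_one (v x₀ - v p) with h | h
      · rw [if_pos (memE p _ m1 (by omega) (by omega) h)]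
        split_ifs <;> omega
      · rw [if_pos (memO p _ m1 (by omega) (by omega) h)]
        split_ifs <;> omega
    · have m2 : p ∈ A (v x₀ - v p + 1) := ⟨by omega, by omega⟩
      rcases Int.emod_two_eq_zero_or_one (v x₀ - v p) with h | h
      · rw [if_pos (memE p _ m1 (by omega) (by omega) h),
          if_pos (memO p _ m2 (by omega) (by omega) (by omega))]
        omega
      · rw [if_pos (memO p _ m1 (by omega) (by omega) h),
          if_pos (memE p _ m2 (by omega) (by omega) (by omega))]
        omega
  have cardsum : ∀ F : Set α, (F.ncard : ℤ) = ∑ p, if p ∈ F then 1 else 0 := by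
    intro F
    rw [Set.ncard_eq_toFinset_card']
    simp [Finset.sum_boole, Set.toFinset]
  calc ∑ x, (u x + v x) ≤ ∑ p, ((if p ∈ O then 1 else 0) + (if p ∈ E then 1 else 0)) :=
        Finset.sum_le_sum fun p _ => key p
    _ = (O.ncard : ℤ) + E.ncard := by rw [Finset.sum_add_distrib, cardsum, cardsum]
    _ ≤ _ := by omega

theorem exists_chainPartition_knorm_add_le [IsPartialOrder α r] (σ : Equiv.Perm α) {k : ℕ}
    (hk : 1 ≤ k) :
    ∃ f : α → α, IsChainPartition r f ∧
      (knorm f k : ℤ) + knorm f (k + 1) ≤ ∑ x, linkCost r k x (σ x) := by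
  classical
  let S : α → α → Prop := fun p q => q = σ p ∧ p ≠ q ∧ r p q
  have hwf : WellFounded fun q p : α => r p q ∧ p ≠ q := by
    have : IsTrans α fun q p : α => r p q ∧ p ≠ q :=
      ⟨fun a b c h1 h2 => ⟨_root_.trans h2.1 h1.1, fun h => by
        subst h; exact h1.2 (antisymm (r := r) h1.1 h2.1)⟩⟩
    have : Std.Irrefl fun q p : α => r p q ∧ p ≠ q := ⟨fun a h => h.2 rfl⟩
    exact Finite.wellFounded_of_trans_of_irrefl _
  have hr : ∀ p q, Relation.ReflTransGen S p q → r p q := by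
    intro p q h
    induction h with
    | refl => exact refl_of r p
    | tail _ h ih => exact _root_.trans ih h.2.2
  have htop : ∀ p, ∃ i, Relation.ReflTransGen S p i ∧ ¬ S i (σ i) := by
    intro p
    induction p using hwf.induction with
    | _ p ih =>
      by_cases h : S p (σ p)
      · obtain ⟨i, h1, h2⟩ := ih (σ p) ⟨h.2.2, h.2.1⟩
        exact ⟨i, Relation.ReflTransGen.head h h1, h2⟩
      · exact ⟨p, .refl, h⟩
  choose f hf hft using htop
  have hchain : IsChainPartition r f := by
    rintro i p rfl q (hq : f q = f p) -
    have hu : Relator.RightUnique (Function.swap S) := by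
      rintro a b c h1 h2
      exact σ.injective (h1.1.symm.trans h2.1)
    have h1 := Relation.reflTransGen_swap.2 (hf p)
    have h2 := Relation.reflTransGen_swap.2 (hq ▸ hf q)
    rcases Relation.ReflTransGen.total_of_right_unique hu h1 h2 with h | h
    · exact Or.inr (hr _ _ (Relation.reflTransGen_swap.1 h))
    · exact Or.inl (hr _ _ (Relation.reflTransGen_swap.1 h))
  refine ⟨f, hchain, ?_⟩
  unfold knorm
  push_cast
  rw [← Finset.sum_add_distrib]
  refine Finset.sum_le_sum fun i _ => ?_
  unfold linkCost
  by_cases h1 : i = σ i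
  · have hsub : f ⁻¹' {i} ⊆ {i} := by
      rintro p (hp : f p = i)
      have h := hf p
      rw [hp] at h
      rcases Relation.ReflTransGen.cases_tail h with h | ⟨b, -, hb⟩
      · exact h.symm
      · exact absurd (σ.injective (hb.1.symm.trans h1)) hb.2.1
    have := Set.ncard_le_ncard hsub
    rw [Set.ncard_singleton] at this
    rw [if_pos h1]
    omega
  · rw [if_neg h1]
    by_cases h2 : r i (σ i)
    · have he : f ⁻¹' {i} = ∅ := by
        rw [Set.eq_empty_iff_forall_notMem]
        rintro p (hp : f p = i)
        exact hft p (hp ▸ ⟨rfl, h1, h2⟩)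
      rw [he]
      simp [h2]
    · rw [if_neg h2]
      omega

/-- The Greene–Kleitman theorem: some chain partition is both `k`- and `(k + 1)`-saturated. -/
theorem exists_saturated_succ [Nonempty α] [IsPartialOrder α r] {k : ℕ} (hk : 1 ≤ k) :
    ∃ f : α → α, IsChainPartition r f ∧ knorm f k = dFam r k ∧
      knorm f (k + 1) = dFam r (k + 1) := by
  obtain ⟨σ, u, v, huv, hσ⟩ := exists_perm_potentials (linkCost r k) fun x y => by
    unfold linkCost; split_ifs <;> omega
  obtain ⟨f, hf, hle⟩ := exists_chainPartition_knorm_add_le (r := r) σ hk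
  have h1 := sum_potentials_le_dFam_add hk huv
  have h2 : ∑ x, (u x + v x) = ∑ x, linkCost r k x (σ x) := by
    rw [← Finset.sum_congr rfl fun x _ => hσ x, Finset.sum_add_distrib, Finset.sum_add_distrib,
      Equiv.sum_comp σ v]
  have h3 := dFam_le_knorm hf k
  have h4 := dFam_le_knorm hf (k + 1)
  exact ⟨f, hf, by omega, by omega⟩

end Duality

section LowerBound

variable {α : Type*} [Fintype α] {r : α → α → Prop}

theorem knorm_concave (f : α → α) (k : ℕ) :
    knorm f (k + 2) + knorm f k ≤ 2 * knorm f (k + 1) := by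
  unfold knorm
  rw [← Finset.sum_add_distrib, Finset.mul_sum]
  exact Finset.sum_le_sum fun i _ => by omega

theorem knorm_two_le (f : α → α) : knorm f 2 ≤ 2 * knorm f 1 := by
  unfold knorm
  rw [Finset.mul_sum]
  exact Finset.sum_le_sum fun i _ => by omega

theorem PolyunsatPO.dFam_strictConcave [Nonempty α] [IsPartialOrder α r] (h : PolyunsatPO r)
    {k : ℕ} (hk : 1 ≤ k) (hkc : k + 2 < heightPO r) :
    dFam r (k + 2) + dFam r k < 2 * dFam r (k + 1) := by
  obtain ⟨f, hf, h1, h2⟩ := exists_saturated_succ (r := r) hk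
  have h3 := knorm_concave f k
  have h4 := dFam_le_knorm hf (k + 2)
  have h5 : knorm f (k + 2) ≠ dFam r (k + 2) := fun h5 =>
    h k (k + 2) (by omega) (by omega) (by omega) hkc (Or.inl le_rfl) ⟨f, hf, h1, h5⟩
  omega

theorem PolyunsatPO.choose_le_card [IsPartialOrder α r] (h : PolyunsatPO r)
    (hc : 3 ≤ heightPO r) : (heightPO r).choose 2 ≤ Fintype.card α := by
  obtain ⟨m, hm⟩ := Nat.exists_eq_add_of_le' hc
  have hcard := dFam_lt_card (r := r) (k := m + 2) (by omega)
  have : Nonempty α := Fintype.card_pos_iff.1 (by omega)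
  have step : ∀ i ≤ m, dFam r (m + 1 - i) + (i + 1) ≤ dFam r (m + 2 - i) := by
    intro i
    induction i with
    | zero => exact fun _ => dFam_lt_dFam_succ (r := r) (k := m + 1) (by omega)
    | succ i ih =>
      intro hi
      have h1 := ih (by omega)
      obtain ⟨j, rfl⟩ := Nat.exists_eq_add_of_le' hi
      have h2 := h.dFam_strictConcave (k := j + 1) (by omega) (by omega)
      have e1 : j + (i + 1) + 1 - i = j + 2 := by omega
      have e2 : j + (i + 1) + 2 - i = j + 3 := by omega
      have e3 : j + (i + 1) + 1 - (i + 1) = j + 1 := by omega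
      have e4 : j + (i + 1) + 2 - (i + 1) = j + 2 := by omega
      rw [e1, e2] at h1
      rw [e3, e4]
      rw [show j + 1 + 2 = j + 3 from rfl, show j + 1 + 1 = j + 2 from rfl] at h2
      omega
  have total : ∀ i ≤ m + 1, dFam r (m + 2 - i) + (i + 1).choose 2 ≤ dFam r (m + 2) := by
    intro i
    induction i with
    | zero => simp
    | succ i ih =>
      intro hi
      have h1 := ih (by omega)
      have h2 := step i (by omega)
      have h3 : (i + 1 + 1).choose 2 = (i + 1) + (i + 1).choose 2 := by
        rw [Nat.choose_succ_succ' (i + 1) 1, Nat.choose_one_right]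
      have e : m + 2 - (i + 1) = m + 1 - i := by omega
      rw [e, h3]
      omega
  have h1 := total (m + 1) le_rfl
  have h2 := step m le_rfl
  obtain ⟨f, hf, h3, -⟩ := exists_saturated_succ (r := r) (k := 1) le_rfl
  have h4 := knorm_two_le f
  have h5 := dFam_le_knorm hf 2
  have e1 : m + 2 - (m + 1) = 1 := by omega
  have e2 : m + 1 - m = 1 := by omega
  have e3 : m + 2 - m = 2 := by omega
  rw [e1] at h1
  rw [e2, e3] at h2
  have h6 : (m + 3).choose 2 = (m + 2) + (m + 2).choose 2 := by
    rw [Nat.choose_succ_succ' (m + 2) 1, Nat.choose_one_right]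
  rw [hm, h6]
  have e4 : m + 1 + 1 = m + 2 := rfl
  rw [e4] at h1
  omega

end LowerBound

section Certificates

variable {α : Type*} {r : α → α → Prop}

/-- Every fiber of `f` lies in `{x | ρ x < k}` or meets all levels of `ρ` below `k`. -/
def MeetsLevels (ρ : α → ℕ) (k : ℕ) (f : α → α) : Prop :=
  ∀ x, k ≤ ρ x → ∀ t < k, ∃ y, f y = f x ∧ ρ y = t

theorem MeetsLevels.of_saturated [Fintype α] {ρ : α → ℕ} {k : ℕ} {f g : α → α}
    (hρ : ∀ x y, r x y → x ≠ y → ρ x = ρ y → k ≤ ρ x) (hg : IsChainPartition r g)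
    (hgρ : MeetsLevels ρ k g) (hf : IsChainPartition r f) (hs : knorm f k = dFam r k) :
    MeetsLevels ρ k f := by
  have hA : ∀ i : Fin k, IsAntichain r {x | ρ x = i} := by
    intro i x (hx : ρ x = i) y (hy : ρ y = i) hne h
    have := hρ x y h hne (by omega)
    omega
  have hU : (⋃ i : Fin k, {x | ρ x = i}) = {x | ρ x < k} := by
    ext x
    simp only [Set.mem_iUnion, Set.mem_ofPred_eq]
    exact ⟨fun ⟨i, hi⟩ => hi ▸ i.2, fun h => ⟨⟨ρ x, h⟩, rfl⟩⟩
  have hle := ncard_iUnion_le_dFam hA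
  rw [hU] at hle
  have h1 : knorm g k ≤ {x | ρ x < k}.ncard := by
    rw [ncard_eq_sum_fibers g]
    refine Finset.sum_le_sum fun i _ => ?_
    by_cases h : ∃ x, g x = i ∧ k ≤ ρ x
    · obtain ⟨x, rfl, hx⟩ := h
      refine (min_le_left _ _).trans ?_
      have hsub : (Finset.range k : Set ℕ) ⊆ ρ '' (g ⁻¹' {g x} ∩ {x | ρ x < k}) := by
        intro t ht
        have ht : t < k := by simpa using ht
        obtain ⟨y, hy, rfl⟩ := hgρ x hx t ht
        exact ⟨y, ⟨hy, ht⟩, rfl⟩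
      have := (Set.ncard_le_ncard hsub).trans Set.ncard_image_le
      rwa [Set.ncard_coe_finset, Finset.card_range] at this
    · push Not at h
      rw [Set.inter_eq_left.2 (show g ⁻¹' {i} ⊆ {x | ρ x < k} from h)]
      exact min_le_right _ _
  have h2 := dFam_le_knorm hg k
  have h3 : ∀ i ∈ univ, (f ⁻¹' {i} ∩ {x | ρ x < k}).ncard ≤ min k (f ⁻¹' {i}).ncard :=
    fun i _ => hU ▸ (hf i).ncard_inter_iUnion_le hA
  have h4 : ∑ i, (f ⁻¹' {i} ∩ {x | ρ x < k}).ncard = ∑ i, min k (f ⁻¹' {i}).ncard := by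
    have : ∑ i, min k (f ⁻¹' {i}).ncard = knorm f k := rfl
    rw [this, ← ncard_eq_sum_fibers f]
    omega
  have h5 := (Finset.sum_eq_sum_iff_of_le h3).1 h4
  intro x hx t ht
  have h6 := h5 (f x) (mem_univ _)
  have h7 : (f ⁻¹' {f x} ∩ {x | ρ x < k}).ncard < (f ⁻¹' {f x}).ncard :=
    Set.ncard_lt_ncard ⟨Set.inter_subset_left, fun h => by
      have : ρ x < k := (h (Set.mem_preimage.2 rfl)).2
      omega⟩
  have hinj : Set.InjOn ρ (f ⁻¹' {f x} ∩ {x | ρ x < k}) := by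
    intro y hy z hz hyz
    by_contra hne
    have h8 : ρ y < k := hy.2
    rcases hf _ hy.1 hz.1 hne with h | h
    · have := hρ _ _ h hne hyz
      omega
    · have := hρ _ _ h (Ne.symm hne) hyz.symm
      omega
  have himg : ρ '' (f ⁻¹' {f x} ∩ {x | ρ x < k}) = (Finset.range k : Set ℕ) := by
    refine Set.eq_of_subset_of_ncard_le ?_ ?_ (Finset.finite_toSet _)
    · rintro _ ⟨y, hy, rfl⟩
      simpa using hy.2
    · rw [hinj.ncard_image, Set.ncard_coe_finset, Finset.card_range]
      omega
  obtain ⟨y, hy, hyt⟩ : t ∈ ρ '' (f ⁻¹' {f x} ∩ {x | ρ x < k}) := by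
    rw [himg]
    simpa using ht
  exact ⟨y, hy.1, hyt⟩

end Certificates

section Staircase

/-- The points `(i, p)` are arranged in tracks: track `i` consists of the foot `(i, 1)`, the spine
point `(i, 0)` and the tail points `(i, p)` with `2 ≤ p`, in this order.
This linear order lists the tracks one after the other. -/
def TrackLE (a b : ℕ × ℕ) : Prop :=
  a.1 < b.1 ∨ a.1 = b.1 ∧ (a.2 = b.2 ∨ a.2 = 1 ∨ a.2 = 0 ∧ 2 ≤ b.2 ∨ 2 ≤ a.2 ∧ a.2 ≤ b.2)

/-- The linear order on points listing the feet with decreasing track, then the spine with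
increasing track, then the tails with decreasing track. -/
def SpineLE (a b : ℕ × ℕ) : Prop :=
  a.2 = 1 ∧ (b.2 ≠ 1 ∨ b.1 ≤ a.1) ∨ a.2 = 0 ∧ (2 ≤ b.2 ∨ b.2 = 0 ∧ a.1 ≤ b.1) ∨
    2 ≤ a.2 ∧ 2 ≤ b.2 ∧ (b.1 < a.1 ∨ a.1 = b.1 ∧ a.2 ≤ b.2)

/-- The two-dimensional order in which spine points increase with the track, and each
track is a chain. -/
def StairLE (a b : ℕ × ℕ) : Prop := TrackLE a b ∧ SpineLE a b

/-- `π` identifies `α` with the triangle `i + p ≤ w` together with additional feet. -/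
structure IsStaircase {α : Type*} (w : ℕ) (π : α → ℕ × ℕ) : Prop where
  injective : Injective π
  exists_eq : ∀ i p, i + p ≤ w → ∃ x, π x = (i, p)
  mem : ∀ x, (π x).1 + (π x).2 ≤ w ∨ (π x).2 = 1

variable {α : Type*} {w : ℕ} {π : α → ℕ × ℕ}

theorem isLinearOrder_trackLE (hπ : Injective π) :
    IsLinearOrder α fun x y => TrackLE (π x) (π y) where
  refl x := by unfold TrackLE; omega
  trans x y z := by unfold TrackLE; omega
  antisymm x y h1 h2 := hπ (by
    unfold TrackLE at h1 h2
    exact Prod.ext (by omega) (by omega))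
  total x y := by unfold TrackLE; omega

theorem isLinearOrder_spineLE (hπ : Injective π) :
    IsLinearOrder α fun x y => SpineLE (π x) (π y) where
  refl x := by unfold SpineLE; omega
  trans x y z := by unfold SpineLE; omega
  antisymm x y h1 h2 := hπ (by
    unfold SpineLE at h1 h2
    exact Prod.ext (by omega) (by omega))
  total x y := by unfold SpineLE; omega

theorem isPartialOrder_stairLE (hπ : Injective π) :
    IsPartialOrder α fun x y => StairLE (π x) (π y) where
  refl x := ⟨(isLinearOrder_trackLE hπ).refl x, (isLinearOrder_spineLE hπ).refl x⟩
  trans x y z h1 h2 := ⟨(isLinearOrder_trackLE hπ).trans x y z h1.1 h2.1,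
    (isLinearOrder_spineLE hπ).trans x y z h1.2 h2.2⟩
  antisymm x y h1 h2 := (isLinearOrder_trackLE hπ).antisymm x y h1.1 h2.1

theorem dimLE2_stairLE (hπ : Injective π) : DimLE2 fun x y => StairLE (π x) (π y) :=
  ⟨_, _, isLinearOrder_trackLE hπ, isLinearOrder_spineLE hπ, fun _ _ h => h.1, fun _ _ h => h.2,
    fun _ _ => Iff.rfl⟩

theorem IsStaircase.exists_points (h : IsStaircase w π) :
    ∃ el : ℕ → ℕ → α, ∀ i p, i + p ≤ w → (π (el i p)).1 = i ∧ (π (el i p)).2 = p := by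
  obtain ⟨x₀, -⟩ := h.exists_eq 0 0 (by omega)
  have : ∀ i p, ∃ x, i + p ≤ w → (π x).1 = i ∧ (π x).2 = p := by
    intro i p
    by_cases hip : i + p ≤ w
    · obtain ⟨x, hx⟩ := h.exists_eq i p hip
      exact ⟨x, fun _ => by simp [hx]⟩
    · exact ⟨x₀, fun h => absurd h hip⟩
  choose el hel using this
  exact ⟨el, hel⟩

theorem IsStaircase.ne_iff (h : IsStaircase w π) {x y : α} :
    x ≠ y ↔ (π x).1 ≠ (π y).1 ∨ (π x).2 ≠ (π y).2 := by
  rw [← h.injective.ne_iff, Ne, Prod.ext_iff]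
  tauto

theorem IsStaircase.heightPO_eq [Fintype α] (h : IsStaircase w π) (hw : 1 ≤ w) :
    heightPO (fun x y => StairLE (π x) (π y)) = w + 2 := by
  let ρ : α → ℕ := fun x => if (π x).2 = 1 then 0 else w + 1 - (π x).1 - (π x).2
  apply le_antisymm
  · obtain ⟨s, hs, hc⟩ := exists_chain_ncard_eq_heightPO fun x y => StairLE (π x) (π y)
    rw [← hc]
    have := Set.ncard_le_ncard_of_injOn (s := s) (t := (Finset.range (w + 2) : Set ℕ)) ρ
      (fun x _ => by
        have := h.mem x
        simp only [Finset.coe_range, Set.mem_Iio, ρ]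
        split_ifs <;> omega)
      (by
        intro x hx y hy hxy
        by_contra hne
        have h1 := h.mem x
        have h2 := h.mem y
        have h3 := h.ne_iff.1 hne
        have h4 := hs hx hy hne
        simp only [StairLE, TrackLE, SpineLE] at h4
        simp only [ρ] at hxy
        split_ifs at hxy <;> omega)
    simpa [Set.ncard_coe_finset] using this
  · obtain ⟨el, hel⟩ := h.exists_points
    let s : Set α := {x | (π x).2 = 0 ∨ (π x).1 = 0 ∧ (π x).2 = 1}
    have hs : IsChain (fun x y => StairLE (π x) (π y)) s := by
      intro x hx y hy hne
      have h3 := h.ne_iff.1 hne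
      simp only [s, Set.mem_ofPred_eq] at hx hy
      simp only [StairLE, TrackLE, SpineLE]
      omega
    have hsub : (Finset.range (w + 2) : Set ℕ) ⊆ ρ '' s := by
      intro t ht
      have ht : t < w + 2 := by simpa using ht
      rcases Nat.eq_zero_or_pos t with rfl | ht0
      · have := hel 0 1 (by omega)
        exact ⟨el 0 1, Or.inr this, by simp [ρ, this]⟩
      · have := hel (w + 1 - t) 0 (by omega)
        refine ⟨el (w + 1 - t) 0, Or.inl this.2, ?_⟩
        simp only [ρ, this, zero_ne_one, if_false]
        omega
    have := (Set.ncard_le_ncard hsub).trans Set.ncard_image_le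
    rw [Set.ncard_coe_finset, Finset.card_range] at this
    exact this.trans (le_csSup (bddAbove_chain_card _) ⟨s, hs, rfl⟩)

/-- The first `j` tracks together with the chain climbing track `j` and then following the spine;
all other points are singletons. -/
theorem IsStaircase.exists_chainPartition (h : IsStaircase w π) {el : ℕ → ℕ → α}
    (hel : ∀ i p, i + p ≤ w → (π (el i p)).1 = i ∧ (π (el i p)).2 = p) {j : ℕ} (hj : j ≤ w) :
    ∃ g : α → α, IsChainPartition (fun x y => StairLE (π x) (π y)) g ∧
      (∀ x, (π x).1 < j → g x = el (π x).1 0) ∧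
      ∀ x, j ≤ (π x).1 → (π x).2 = 0 ∨ (π x).2 = 1 ∧ (π x).1 = j → g x = el j 0 := by
  classical
  let g : α → α := fun x => if (π x).1 < j then el (π x).1 0 else
    if (π x).2 = 0 ∨ (π x).2 = 1 ∧ (π x).1 = j then el j 0 else x
  refine ⟨g, ?_, fun x hx => if_pos hx, fun x hx hx' => ?_⟩
  · rintro z x hx y (hy : g y = z) hne
    have hx : g x = z := hx
    have h1 := h.mem x
    have h2 := h.mem y
    have h3 := h.ne_iff.1 hne
    rw [← hy] at hx
    have h4 := congrArg (fun x => (π x).1) hx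
    have h5 := congrArg (fun x => (π x).2) hx
    have h6 : (π x).1 < j → _ := fun hxj => hel (π x).1 0 (by omega)
    have h7 : (π y).1 < j → _ := fun hyj => hel (π y).1 0 (by omega)
    have h8 := hel j 0 (by omega)
    simp only [g] at h4 h5
    simp only [StairLE, TrackLE, SpineLE]
    split_ifs at h4 h5 <;> omega
  · simp only [g]
    rw [if_neg (by omega), if_pos hx']

/-- A `k`-saturated partition does not separate adjacent spine points high up. -/
theorem IsStaircase.eq_of_saturated [Fintype α] (h : IsStaircase w π) {el : ℕ → ℕ → α}
    (hel : ∀ i p, i + p ≤ w → (π (el i p)).1 = i ∧ (π (el i p)).2 = p) {k : ℕ} (hk : 3 ≤ k)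
    (hkw : k ≤ w + 1) {f : α → α} (hf : IsChainPartition (fun x y => StairLE (π x) (π y)) f)
    (hs : knorm f k = dFam (fun x y => StairLE (π x) (π y)) k) :
    f (el (w + 1 - k) 0) = f (el (w + 2 - k) 0) := by
  let ρ : α → ℕ := fun x => if (π x).2 = 1 then 0 else w + 1 - (π x).1 - (π x).2
  obtain ⟨g, hg, hg1, hg2⟩ := h.exists_chainPartition hel (j := w + 1 - k) (by omega)
  have hgρ : MeetsLevels ρ k g := by
    intro x hx t ht
    have hm := h.mem x
    simp only [ρ] at hx
    split_ifs at hx with hx1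
    · omega
    by_cases hxj : (π x).1 < w + 1 - k
    · rw [hg1 x hxj]
      rcases Nat.eq_zero_or_pos t with rfl | ht0
      · have e := hel (π x).1 1 (by omega)
        refine ⟨el (π x).1 1, ?_, by simp [ρ, e]⟩
        rw [hg1 _ (by omega), e.1]
      · have e := hel (π x).1 (w + 1 - (π x).1 - t) (by omega)
        refine ⟨_, by rw [hg1 _ (by rw [e.1]; omega), e.1], ?_⟩
        simp only [ρ]
        rw [if_neg (by omega)]
        omega
    · rw [hg2 x (by omega) (by omega)]
      rcases Nat.eq_zero_or_pos t with rfl | ht0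
      · have e := hel (w + 1 - k) 1 (by omega)
        exact ⟨el (w + 1 - k) 1, hg2 _ (by omega) (by omega), by simp [ρ, e]⟩
      · have e := hel (w + 1 - t) 0 (by omega)
        refine ⟨el (w + 1 - t) 0, hg2 _ (by omega) (by omega), ?_⟩
        simp only [ρ]
        rw [if_neg (by omega)]
        omega
  have hρ : ∀ x y, StairLE (π x) (π y) → x ≠ y → ρ x = ρ y → k ≤ ρ x := by
    intro x y hxy hne he
    have h1 := h.mem x
    have h2 := h.mem y
    have h3 := h.ne_iff.1 hne
    simp only [StairLE, TrackLE, SpineLE] at hxy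
    simp only [ρ] at he ⊢
    split_ifs at he ⊢ <;> omega
  have e := hel (w + 1 - k) 0 (by omega)
  have e' := hel (w + 2 - k) 0 (by omega)
  obtain ⟨y, hy, hyk⟩ := MeetsLevels.of_saturated hρ hg hgρ hf hs (el (w + 1 - k) 0)
    (by simp only [ρ]; rw [if_neg (by omega)]; omega) (k - 1) (by omega)
  have hne : y ≠ el (w + 1 - k) 0 := by
    rintro rfl
    simp only [ρ] at hyk
    split_ifs at hyk <;> omega
  have hcmp := hf _ (show f y = _ from rfl) (show f _ = _ from hy.symm) hne
  have hm := h.mem y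
  have : y = el (w + 2 - k) 0 := by
    refine h.injective (Prod.ext ?_ ?_)
    all_goals
      simp only [StairLE, TrackLE, SpineLE] at hcmp
      simp only [ρ] at hyk
      split_ifs at hyk <;> omega
  rw [← hy, this]

/-- A `k`-saturated partition separates adjacent spine points low down. -/
theorem IsStaircase.ne_of_saturated [Fintype α] (h : IsStaircase w π) {el : ℕ → ℕ → α}
    (hel : ∀ i p, i + p ≤ w → (π (el i p)).1 = i ∧ (π (el i p)).2 = p) {k i : ℕ} (hk : 1 ≤ k)
    (hki : k + i + 1 ≤ w) {f : α → α} (hf : IsChainPartition (fun x y => StairLE (π x) (π y)) f)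
    (hs : knorm f k = dFam (fun x y => StairLE (π x) (π y)) k) :
    f (el i 0) ≠ f (el (i + 1) 0) := by
  let ρ : α → ℕ := fun x =>
    if (π x).2 = 1 then (if i < (π x).1 then 0 else k)
    else if (π x).2 = 0 ∧ (π x).1 = i then 0
    else if 2 ≤ (π x).2 ∧ (π x).1 < i ∧ w + 1 - (π x).1 - (π x).2 = k then 0
    else w + 1 - (π x).1 - (π x).2
  obtain ⟨g, hg, hg1, hg2⟩ := h.exists_chainPartition hel (j := w - k) (by omega)
  have hgρ : MeetsLevels ρ k g := by
    intro x hx t ht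
    have hm := h.mem x
    by_cases hxj : (π x).1 < w - k
    · rw [hg1 x hxj]
      rcases Nat.eq_zero_or_pos t with rfl | ht0
      · rcases lt_trichotomy (π x).1 i with hi | hi | hi
        · have e := hel (π x).1 (w + 1 - (π x).1 - k) (by omega)
          refine ⟨_, by rw [hg1 _ (by rw [e.1]; omega), e.1], ?_⟩
          simp only [ρ]
          split_ifs <;> omega
        · have e := hel (π x).1 0 (by omega)
          refine ⟨_, by rw [hg1 _ (by rw [e.1]; omega), e.1], ?_⟩
          simp only [ρ]
          split_ifs <;> omega
        · have e := hel (π x).1 1 (by omega)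
          refine ⟨_, by rw [hg1 _ (by rw [e.1]; omega), e.1], ?_⟩
          simp only [ρ]
          split_ifs <;> omega
      · have e := hel (π x).1 (w + 1 - (π x).1 - t) (by omega)
        refine ⟨_, by rw [hg1 _ (by rw [e.1]; omega), e.1], ?_⟩
        simp only [ρ]
        split_ifs <;> omega
    · have hx0 : (π x).2 = 0 := by
        simp only [ρ] at hx
        split_ifs at hx <;> omega
      rw [hg2 x (by omega) (by omega)]
      rcases Nat.eq_zero_or_pos t with rfl | ht0
      · have e := hel (w - k) 1 (by omega)
        refine ⟨el (w - k) 1, hg2 _ (by omega) (by omega), ?_⟩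
        simp only [ρ]
        split_ifs <;> omega
      · have e := hel (w + 1 - t) 0 (by omega)
        refine ⟨el (w + 1 - t) 0, hg2 _ (by omega) (by omega), ?_⟩
        simp only [ρ]
        split_ifs <;> omega
  have hρ : ∀ x y, StairLE (π x) (π y) → x ≠ y → ρ x = ρ y → k ≤ ρ x := by
    intro x y hxy hne he
    have h1 := h.mem x
    have h2 := h.mem y
    have h3 := h.ne_iff.1 hne
    simp only [StairLE, TrackLE, SpineLE] at hxy
    simp only [ρ] at he ⊢
    split_ifs at he ⊢ <;> omega
  have e := hel i 0 (by omega)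
  have e' := hel (i + 1) 0 (by omega)
  have e2 := hel i 2 (by omega)
  obtain ⟨y, hy, hyk⟩ := MeetsLevels.of_saturated hρ hg hgρ hf hs (el i 2)
    (by simp only [ρ]; split_ifs <;> omega) 0 (by omega)
  have hne : y ≠ el i 2 := by
    rintro rfl
    simp only [ρ] at hyk
    split_ifs at hyk <;> omega
  have hcmp := hf _ (show f y = _ from rfl) (show f _ = _ from hy.symm) hne
  have hm := h.mem y
  have hyi : y = el i 0 := by
    refine h.injective (Prod.ext ?_ ?_)
    all_goals
      simp only [StairLE, TrackLE, SpineLE] at hcmp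
      simp only [ρ] at hyk
      split_ifs at hyk <;> omega
  intro heq
  have hne' : el (i + 1) 0 ≠ el i 2 := h.ne_iff.2 (by omega)
  have hcmp' := hf _ (show f _ = _ from rfl) (show f _ = _ from (heq.symm.trans (hyi ▸ hy)).symm)
    hne'
  simp only [StairLE, TrackLE, SpineLE] at hcmp'
  omega

theorem IsStaircase.polyunsatPO [Fintype α] (h : IsStaircase w π) (hw : 1 ≤ w) :
    PolyunsatPO fun x y => StairLE (π x) (π y) := by
  obtain ⟨el, hel⟩ := h.exists_points
  have key : ∀ k l, 0 < k → k + 2 ≤ l → l < w + 2 → ∀ f : α → α,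
      IsChainPartition (fun x y => StairLE (π x) (π y)) f →
      knorm f k = dFam (fun x y => StairLE (π x) (π y)) k →
      knorm f l ≠ dFam (fun x y => StairLE (π x) (π y)) l := by
    intro k l hk hkl hl f hf h1 h2
    have h3 := h.eq_of_saturated hel (k := l) (by omega) (by omega) hf h2
    have h4 := h.ne_of_saturated hel (i := w + 1 - l) hk (by omega) hf h1
    rw [show w + 1 - l + 1 = w + 2 - l by omega] at h4
    exact h4 h3
  rw [PolyunsatPO, h.heightPO_eq hw]
  rintro k l hk hl hkc hlc (hkl | hkl) ⟨f, hf, h1, h2⟩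
  · exact key k l hk hkl hlc f hf h1 h2
  · exact key l k hl hkl hkc f hf h2 h1

theorem exists_triangle (w : ℕ) :
    ∃ X : Finset (ℕ × ℕ), #X = (w + 2).choose 2 ∧ ∀ a : ℕ × ℕ, a ∈ X ↔ a.1 + a.2 ≤ w := by
  induction w with
  | zero => exact ⟨{(0, 0)}, by simp, fun a => by simp [Prod.ext_iff]⟩
  | succ w ih =>
    obtain ⟨X, hX, hm⟩ := ih
    refine ⟨X.disjUnion (antidiagonal (w + 1)) ?_, ?_, fun a => ?_⟩
    · rw [Finset.disjoint_left]
      intro a ha hb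
      rw [hm] at ha
      rw [HasAntidiagonal.mem_antidiagonal] at hb
      omega
    · have h : (w + 1 + 2).choose 2 = (w + 2) + (w + 2).choose 2 := by
        rw [Nat.choose_succ_succ' (w + 2) 1, Nat.choose_one_right]
      rw [Finset.card_disjUnion, hX, Finset.Nat.card_antidiagonal, h]
      omega
    · rw [mem_disjUnion, hm, HasAntidiagonal.mem_antidiagonal]
      omega

theorem exists_isStaircase {n w : ℕ} (hn : (w + 2).choose 2 ≤ n) :
    ∃ π : Fin n → ℕ × ℕ, IsStaircase w π := by
  obtain ⟨X, hX, hm⟩ := exists_triangle w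
  let Y : Finset (ℕ × ℕ) := (range (n - #X)).map
    ⟨fun q => (w + q, 1), fun a b hab => Nat.add_left_cancel (Prod.ext_iff.1 hab).1⟩
  have hY : ∀ a ∈ Y, w < a.1 + a.2 ∧ a.2 = 1 := by
    intro a ha
    obtain ⟨q, -, rfl⟩ := Finset.mem_map.1 ha
    exact ⟨by change w < w + q + 1; omega, rfl⟩
  have hd : Disjoint X Y := Finset.disjoint_left.2 fun a ha hb => by
    have h1 := (hm a).1 ha
    have h2 := (hY a hb).1
    omega
  have hc : #(X.disjUnion Y hd) = n := by
    rw [Finset.card_disjUnion, Finset.card_map, Finset.card_range]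
    omega
  let e := (X.disjUnion Y hd).equivFinOfCardEq hc
  refine ⟨fun x => (e.symm x : ℕ × ℕ), Subtype.val_injective.comp e.symm.injective,
    fun i p hip => ?_, fun x => ?_⟩
  · exact ⟨e ⟨(i, p), mem_disjUnion.2 (Or.inl ((hm _).2 hip))⟩, by simp⟩
  · rcases mem_disjUnion.1 (e.symm x).2 with hx | hx
    · exact Or.inl ((hm _).1 hx)
    · exact Or.inr (hY _ hx).2

end Staircase

/-- For positive integers `n` and `c` with `c ≥ 3`: there is an `n`-element
polyunsaturated poset with height `c` iff `n ≥ c.choose 2`; moreover, in that case the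
poset may be required to have order dimension at most 2. -/
theorem statement19 (n c : ℕ) (hn : 0 < n) (hc : 3 ≤ c) :
    ((∃ r : Fin n → Fin n → Prop,
        IsPartialOrder (Fin n) r ∧ heightPO r = c ∧ PolyunsatPO r) ↔
      c.choose 2 ≤ n) ∧
    (c.choose 2 ≤ n →
      ∃ r : Fin n → Fin n → Prop,
        IsPartialOrder (Fin n) r ∧ heightPO r = c ∧ PolyunsatPO r ∧ DimLE2 r) := by
  have hex : c.choose 2 ≤ n → ∃ r : Fin n → Fin n → Prop,
      IsPartialOrder (Fin n) r ∧ heightPO r = c ∧ PolyunsatPO r ∧ DimLE2 r := by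
    intro hcn
    obtain ⟨w, rfl⟩ := Nat.exists_eq_add_of_le' (show 2 ≤ c by omega)
    obtain ⟨π, h⟩ := exists_isStaircase hcn
    exact ⟨_, isPartialOrder_stairLE h.injective, h.heightPO_eq (by omega),
      h.polyunsatPO (by omega), dimLE2_stairLE h.injective⟩
  refine ⟨⟨?_, fun hcn => ?_⟩, hex⟩
  · rintro ⟨r, hr, rfl, hp⟩
    simpa using hp.choose_le_card hc
  · obtain ⟨r, h1, h2, h3, -⟩ := hex hcn
    exact ⟨r, h1, h2, h3⟩
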